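/- Fix a Euclidean unit vector ν₀ ∈ E and suppose v₀ ∈ S is supported by ν₀ (i.e., ⟨ν₀, z⟩ ≤ ⟨ν₀, v₀⟩ for all z with N(z) ≤ 1) and v₀ has regular direction. For v, w ∈ S with ⟨ν₀,v⟩ > 0 and ⟨ν₀,w⟩ > 0, set θ(v,w) = ⟨ν₀,v⟩/⟨ν₀,w⟩ (the unique scalar with v − θ(v,w)·w Euclidean-orthogonal to ν₀), and define Θ(v,w) = (1 − θ(v,w))/N(v − θ(v,w)·w) when v ≠ w and Θ(v,v) = 0. Then Θ is continuous at (v₀,v₀): for every ε > 0 there is δ > 0 such that for all v, w ∈ S with ⟨ν₀,v⟩ > 0, ⟨ν₀,w⟩ > 0, |v − v₀| < δ and |w − v₀| < δ, one has |Θ(v,w)| < ε. -/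

import Mathlib

open scoped RealInnerProductSpace

/- `Θ(v,w) = (1 - θ(v,w)) / N (v - θ(v,w) • w)` where `θ(v,w) = ⟪ν₀,v⟫/⟪ν₀,w⟫` is the
unique scalar with `v - θ(v,w) • w` Euclidean-orthogonal to `ν₀`; and `Θ(v,v) = 0`. -/
open Classical in
noncomputable def Theta {n : ℕ} (N : EuclideanSpace ℝ (Fin n) → ℝ)
    (ν₀ v w : EuclideanSpace ℝ (Fin n)) : ℝ :=
  if v = w then 0
  else (1 - ⟪ν₀, v⟫ / ⟪ν₀, w⟫) / N (v - (⟪ν₀, v⟫ / ⟪ν₀, w⟫) • w)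

section SupportFunctionals

variable {E : Type*} [NormedAddCommGroup E] [InnerProductSpace ℝ E]

/-- If only one unit vector `ν₀` supports the unit ball of `p` at `v₀`, then only one
functional dominated by `p` takes the value `1` at `v₀`. -/
theorem Seminorm.eq_smul_of_inner_eq_one (p : Seminorm ℝ E) {ν₀ v₀ : E}
    (huniq : ∀ ν : E, ‖ν‖ = 1 → (∀ z, p z ≤ 1 → ⟪ν, z⟫ ≤ ⟪ν, v₀⟫) → ν = ν₀)
    {g : E} (hg : ∀ z, ⟪g, z⟫ ≤ p z) (hgv : ⟪g, v₀⟫ = 1) : g = ⟪ν₀, v₀⟫⁻¹ • ν₀ := by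
  have hg0 : 0 < ‖g‖ := norm_pos_iff.mpr fun h => by simp [h] at hgv
  have hν : ‖g‖⁻¹ • g = ν₀ := by
    refine huniq _ (by simp [norm_smul, hg0.ne']) fun z hz => ?_
    rw [real_inner_smul_left, real_inner_smul_left, hgv]
    exact mul_le_mul_of_nonneg_left ((hg z).trans hz) (inv_nonneg.mpr hg0.le)
  rw [← hν, real_inner_smul_left, hgv, mul_one, inv_inv, smul_smul, mul_inv_cancel₀ hg0.ne',
    one_smul]

variable [FiniteDimensional ℝ E]

theorem Seminorm.continuous_of_finiteDimensional_real (p : Seminorm ℝ E) : Continuous p :=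
  p.convexOn.locallyLipschitz.continuous

theorem Seminorm.exists_mul_norm_le (p : Seminorm ℝ E) (hp : ∀ z, p z = 0 → z = 0) :
    ∃ c > 0, ∀ z, c * ‖z‖ ≤ p z := by
  rcases subsingleton_or_nontrivial E with hE | hE
  · exact ⟨1, one_pos, fun z => by simp [Subsingleton.elim z 0]⟩
  obtain ⟨x, hx, hmin⟩ := (isCompact_sphere (0 : E) 1).exists_isMinOn
    (NormedSpace.sphere_nonempty.mpr zero_le_one)
    p.continuous_of_finiteDimensional_real.continuousOn
  have hx1 : ‖x‖ = 1 := by simpa using hx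
  refine ⟨p x, lt_of_le_of_ne (apply_nonneg p x) fun h => ?_, fun z => ?_⟩
  · rw [hp x h.symm, norm_zero] at hx1
    exact zero_ne_one hx1
  · rcases eq_or_ne z 0 with rfl | hz
    · simp
    · have hz' : 0 < ‖z‖ := norm_pos_iff.mpr hz
      have hmem : ‖z‖⁻¹ • z ∈ Metric.sphere (0 : E) 1 := by
        simp [norm_smul, hz'.ne']
      have h := isMinOn_iff.mp hmin _ hmem
      rw [map_smul_eq_mul, norm_inv, norm_norm, inv_mul_eq_div, le_div_iff₀ hz'] at h
      exact h

theorem Seminorm.exists_inner_le_eq (p : Seminorm ℝ E) {v : E} (hv : v ≠ 0) :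
    ∃ g : E, (∀ z, ⟪g, z⟫ ≤ p z) ∧ ⟪g, v⟫ = p v := by
  let f : E →ₗ.[ℝ] ℝ := LinearPMap.mkSpanSingleton v (p v) hv
  have hf : ∀ x : f.domain, f x ≤ p x := by
    rintro ⟨x, hx⟩
    obtain ⟨c, rfl⟩ := Submodule.mem_span_singleton.mp hx
    have h : f ⟨c • v, hx⟩ = c * p v := LinearPMap.mkSpanSingleton'_apply _ _ _ _ _
    rw [h, map_smul_eq_mul]
    exact mul_le_mul_of_nonneg_right (Real.le_norm_self c) (apply_nonneg p v)
  obtain ⟨φ, hφf, hφp⟩ := exists_extension_of_le_sublinear f p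
    (fun c hc x => by rw [map_smul_eq_mul, Real.norm_of_nonneg hc.le]) (map_add_le_add p) hf
  refine ⟨(InnerProductSpace.toDual ℝ E).symm (LinearMap.toContinuousLinearMap φ),
    fun z => by simpa using hφp z, ?_⟩
  have h := hφf ⟨v, Submodule.mem_span_singleton_self v⟩
  simpa using h.trans (LinearPMap.mkSpanSingleton'_apply_self _ _ _ _)

theorem Seminorm.isCompact_setOf_inner_le (p : Seminorm ℝ E) :
    IsCompact {g : E | ∀ z, ⟪g, z⟫ ≤ p z} := by
  obtain ⟨C, hC0, hC⟩ :=
    Seminorm.bound_of_continuous_normedSpace p p.continuous_of_finiteDimensional_real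
  refine Metric.isCompact_of_isClosed_isBounded ?_ ?_
  · rw [Set.ofPred_forall]
    exact isClosed_iInter fun z => isClosed_le (by fun_prop) continuous_const
  · refine isBounded_iff_forall_norm_le.mpr ⟨C, fun g hg => ?_⟩
    have h := (hg g).trans (hC g)
    rw [real_inner_self_eq_norm_mul_norm] at h
    nlinarith [norm_nonneg g]

/-- If a unique functional supports the unit ball of `p` at `v₀`, then the supporting
functionals at nearby unit vectors are close to it. -/
theorem Seminorm.exists_norm_sub_lt_of_unique_support (p : Seminorm ℝ E) {v₀ g₀ : E}
    (huniq : ∀ g : E, (∀ z, ⟪g, z⟫ ≤ p z) → ⟪g, v₀⟫ = 1 → g = g₀) (hv₀ : p v₀ = 1)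
    {η : ℝ} (hη : 0 < η) :
    ∃ δ > 0, ∀ v g : E, ‖v - v₀‖ < δ → (∀ z, ⟪g, z⟫ ≤ p z) → ⟪g, v⟫ = 1 → ‖g - g₀‖ < η := by
  obtain ⟨C, hC0, hC⟩ :=
    Seminorm.bound_of_continuous_normedSpace p p.continuous_of_finiteDimensional_real
  have hK : IsCompact ({g : E | ∀ z, ⟪g, z⟫ ≤ p z} ∩ {g | η ≤ ‖g - g₀‖}) :=
    p.isCompact_setOf_inner_le.inter_right (isClosed_le continuous_const (by fun_prop))
  rcases Set.eq_empty_or_nonempty ({g : E | ∀ z, ⟪g, z⟫ ≤ p z} ∩ {g | η ≤ ‖g - g₀‖})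
    with hempty | hne
  · refine ⟨1, one_pos, fun v g _ hg _ => ?_⟩
    by_contra! hle
    exact Set.eq_empty_iff_forall_notMem.mp hempty g ⟨hg, hle⟩
  obtain ⟨g₁, ⟨hg₁, hg₁η⟩, hmax⟩ := hK.exists_isMaxOn hne
    (f := fun g => ⟪g, v₀⟫) (by fun_prop)
  have hlt : ⟪g₁, v₀⟫ < 1 := by
    refine lt_of_le_of_ne (hv₀ ▸ hg₁ v₀) fun h => ?_
    have hη' : η ≤ ‖g₁ - g₀‖ := hg₁η
    rw [huniq g₁ hg₁ h, sub_self, norm_zero] at hη'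
    exact hη.not_ge hη'
  refine ⟨(1 - ⟪g₁, v₀⟫) / C, div_pos (sub_pos.mpr hlt) hC0, fun v g hvδ hg hgv => ?_⟩
  by_contra! hle
  have h1 : ⟪g, v₀⟫ ≤ ⟪g₁, v₀⟫ := isMaxOn_iff.mp hmax g ⟨hg, hle⟩
  have h2 : ⟪g, v - v₀⟫ ≤ C * ‖v - v₀‖ := (hg _).trans (hC _)
  rw [inner_sub_right, hgv] at h2
  rw [lt_div_iff₀ hC0] at hvδ
  linarith

end SupportFunctionals

/-- If `v₀` is a point of the unit sphere of the strictly convex norm `N` supported by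
the Euclidean unit vector `ν₀`, and `v₀` has regular direction (unique supporting
hyperplane), then `Θ` is continuous at `(v₀, v₀)`. -/
theorem theta_continuous_at_regular_direction {n : ℕ}
    (N : EuclideanSpace ℝ (Fin n) → ℝ)
    (hN0 : ∀ z, N z = 0 ↔ z = 0)
    (hNh : ∀ (c : ℝ) (z : EuclideanSpace ℝ (Fin n)), N (c • z) = |c| * N z)
    (hNt : ∀ z w : EuclideanSpace ℝ (Fin n), N (z + w) ≤ N z + N w)
    (hsc : ∀ x y : EuclideanSpace ℝ (Fin n), N x = 1 → N y = 1 → x ≠ y →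
      N ((2 : ℝ)⁻¹ • (x + y)) < 1)
    (ν₀ v₀ : EuclideanSpace ℝ (Fin n)) (hν₀ : ‖ν₀‖ = 1) (hv₀ : N v₀ = 1)
    (hsupp : ∀ z, N z ≤ 1 → ⟪ν₀, z⟫ ≤ ⟪ν₀, v₀⟫)
    (hreg : ∃! ν : EuclideanSpace ℝ (Fin n),
      ‖ν‖ = 1 ∧ ∀ z, N z ≤ 1 → ⟪ν, z⟫ ≤ ⟪ν, v₀⟫) :
    ∀ ε > 0, ∃ δ > 0, ∀ v w : EuclideanSpace ℝ (Fin n),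
      N v = 1 → N w = 1 → 0 < ⟪ν₀, v⟫ → 0 < ⟪ν₀, w⟫ →
      ‖v - v₀‖ < δ → ‖w - v₀‖ < δ → |Theta N ν₀ v w| < ε := by
  intro ε hε
  let p : Seminorm ℝ (EuclideanSpace ℝ (Fin n)) := Seminorm.of N hNt hNh
  have huniq : ∀ ν, ‖ν‖ = 1 → (∀ z, p z ≤ 1 → ⟪ν, z⟫ ≤ ⟪ν, v₀⟫) → ν = ν₀ :=
    fun ν h1 h2 => hreg.unique ⟨h1, h2⟩ ⟨hν₀, hsupp⟩
  obtain ⟨c, hc, hcp⟩ := p.exists_mul_norm_le fun z => (hN0 z).mp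
  obtain ⟨δ, hδ, hclose⟩ := p.exists_norm_sub_lt_of_unique_support
    (fun g => p.eq_smul_of_inner_eq_one huniq) hv₀ (half_pos (mul_pos hε hc))
  refine ⟨δ, hδ, fun v w hv hw hνv hνw hvδ hwδ => ?_⟩
  unfold Theta
  split_ifs with hvw
  · simpa using hε
  set t := ⟪ν₀, v⟫ / ⟪ν₀, w⟫ with ht
  set u := v - t • w with hu
  have hu_orth : ⟪ν₀, u⟫ = 0 := by
    rw [hu, inner_sub_right, real_inner_smul_right, ht, div_mul_cancel₀ _ hνw.ne', sub_self]
  have hsmall : ∀ x, N x = 1 → ‖x - v₀‖ < δ →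
      ∃ g, (∀ z, ⟪g, z⟫ ≤ N z) ∧ ⟪g, x⟫ = 1 ∧ |⟪g, u⟫| ≤ ε / 2 * N u := by
    intro x hx hxδ
    obtain ⟨g, hg, hgx⟩ := p.exists_inner_le_eq (v := x)
      fun h => by simp [(hN0 x).mpr h] at hx
    replace hgx : ⟪g, x⟫ = 1 := hgx.trans hx
    refine ⟨g, hg, hgx, ?_⟩
    have hlt := hclose x g hxδ hg hgx
    have h := abs_real_inner_le_norm (g - ⟪ν₀, v₀⟫⁻¹ • ν₀) u
    rw [inner_sub_left, real_inner_smul_left, hu_orth, mul_zero, sub_zero] at h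
    have hcu : c * ‖u‖ ≤ N u := hcp u
    nlinarith [mul_le_mul_of_nonneg_right hlt.le (norm_nonneg u)]
  obtain ⟨g, hg, hgv, hgu⟩ := hsmall v hv hvδ
  obtain ⟨k, hk, hkw, hku⟩ := hsmall w hw hwδ
  have ht0 : 0 < t := div_pos hνv hνw
  have hupper : 1 - t ≤ ⟪g, u⟫ := by
    have h := hg w
    rw [hw] at h
    rw [hu, inner_sub_right, real_inner_smul_right, hgv]
    nlinarith
  have hlower : ⟪k, u⟫ ≤ 1 - t := by
    have h := hk v
    rw [hv] at h
    rw [hu, inner_sub_right, real_inner_smul_right, hkw]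
    linarith
  have habs : |1 - t| ≤ ε / 2 * N u :=
    abs_le.mpr ⟨(abs_le.mp hku).1.trans hlower, hupper.trans (abs_le.mp hgu).2⟩
  have hNu : 0 ≤ N u := apply_nonneg p u
  rw [abs_div, abs_of_nonneg hNu]
  exact (div_le_of_le_mul₀ hNu (half_pos hε).le habs).trans_lt (half_lt_self hε)
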